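/- arXiv:1404.2216 — 3 statements merged into one kernel-verified Lean document; each statement's English description precedes it below -/
import Mathlib

section
/- For every real matrix A = (A^{ij})_{i,j∈ℕ}, the operator norm of A on ℓ²(ℕ) equals the X-norm of the sequence L(A), i.e. ‖A‖_{ℓ²(ℕ)→ℓ²(ℕ)} = ‖L(A)‖_X as elements of [0,∞]. In particular, A is bounded on ℓ²(ℕ) if and only if the space-independent paraproduct sequence L(A) lies in X. -/
open MeasureTheory
open scoped ENNReal

noncomputable section

/-- A sequence `λ = (λ_{IJ})` indexed by pairs of dyadic intervals; a dyadic interval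
`[2^{-i}k, 2^{-i}(k+1))` is encoded by the pair `(i, k) : ℤ × ℤ`. -/
abbrev ParaSeq := (ℤ × ℤ) → (ℤ × ℤ) → ℝ

/-- The dyadic interval `[2^{-i} k, 2^{-i}(k+1))` encoded by the pair `p = (i, k) : ℤ × ℤ`. -/
def dyadic (p : ℤ × ℤ) : Set ℝ := Set.Ico ((2:ℝ) ^ (-p.1) * p.2) ((2:ℝ) ^ (-p.1) * (p.2 + 1))

/-- The length `|I| = 2^{-i}` of the dyadic interval encoded by `p = (i, k)`. -/
def dlen (p : ℤ × ℤ) : ℝ := (2:ℝ) ^ (-p.1)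

/-- The average `⟨f⟩_I = |I|⁻¹ ∫_I f`. -/
def avg (f : ℝ → ℝ) (p : ℤ × ℤ) : ℝ := (dlen p)⁻¹ * ∫ x in dyadic p, f x

/-- Admissible families `(u_I)_{I ∈ D}` of `L²(ℝ)` functions: only finitely many nonzero
members and `Σ_I ‖u_I‖₂² = 1`. -/
def Adm : Set ((ℤ × ℤ) → ℝ → ℝ) :=
  {u | (∀ p, MemLp (u p) 2 volume) ∧ {p | u p ≠ 0}.Finite ∧ (∑' p : ℤ × ℤ, ∫ x, (u p x) ^ 2) = 1}

/-- The bilinear sum `Σ_{I,J} λ_{IJ} ⟨g_J⟩_I ⟨u_I⟩_J`. -/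
def pairSum (lam : ParaSeq) (u g : (ℤ × ℤ) → ℝ → ℝ) : ℝ :=
  ∑' pq : (ℤ × ℤ) × (ℤ × ℤ), lam pq.1 pq.2 * avg (g pq.2) pq.1 * avg (u pq.1) pq.2

/-- The norm `‖λ‖_X`, as an element of `[0, ∞]`. -/
def Xnorm (lam : ParaSeq) : ℝ≥0∞ :=
  ⨆ (u : Adm) (g : Adm), ENNReal.ofReal |pairSum lam u.1 g.1|

/-- The norm `‖λ‖_{X'}`, as an element of `[0, ∞]`. -/
def Xprime (lam : ParaSeq) : ℝ≥0∞ :=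
  ⨆ (u : Adm) (g : Adm),
    ENNReal.ofReal
      (∑' pq : (ℤ × ℤ) × (ℤ × ℤ), |lam pq.1 pq.2 * avg (g.1 pq.2) pq.1 * avg (u.1 pq.1) pq.2|)

open Classical in
/-- The map `L`: `L(A)_{IJ} = 2^{-(i+j)/2} A^{ij}` if `I × J ⊆ [0,1)²` (and then necessarily
`(|I|,|J|) = (2^{-i}, 2^{-j})` with `i, j ∈ ℕ`), and `L(A)_{IJ} = 0` if `I × J ⊄ [0,1)²`. -/
def Lmap (A : ℕ → ℕ → ℝ) : ParaSeq := fun p q =>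
  if dyadic p ⊆ Set.Ico (0:ℝ) 1 ∧ dyadic q ⊆ Set.Ico (0:ℝ) 1 then
    (2:ℝ) ^ (-(((p.1 : ℝ) + (q.1 : ℝ)) / 2)) * A p.1.toNat q.1.toNat
  else 0

/-- Finitely supported unit vectors of `ℓ²(ℕ)`. -/
def FinUnit : Set (ℕ → ℝ) := {a | (Function.support a).Finite ∧ (∑' i, (a i) ^ 2) = 1}

/-- The operator norm `‖A‖_{ℓ²(ℕ) → ℓ²(ℕ)}` of a matrix, as an element of `[0, ∞]`. -/
def matNorm (A : ℕ → ℕ → ℝ) : ℝ≥0∞ :=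
  ⨆ (a : FinUnit) (b : FinUnit),
    ENNReal.ofReal |∑' ij : ℕ × ℕ, A ij.1 ij.2 * a.1 ij.1 * b.1 ij.2|

/-- The square root `2^{-i/2}` of the length of a dyadic interval of generation `i`. -/
def rootLen (i : ℕ) : ℝ := (2:ℝ) ^ (-((i:ℝ) / 2))

lemma rootLen_pos (i : ℕ) : 0 < rootLen i := by unfold rootLen; positivity

lemma dlen_natCast (i : ℕ) (k : ℤ) : dlen ((i:ℤ), k) = rootLen i * rootLen i := by
  unfold dlen rootLen
  rw [← Real.rpow_add two_pos, ← Real.rpow_intCast]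
  congr 1
  push_cast
  ring

lemma rootLen_sq_mul (i : ℕ) : (2:ℝ) ^ i * (rootLen i * rootLen i) = 1 := by
  rw [← dlen_natCast i 0]
  simp [dlen]

lemma dlen_pos (p : ℤ × ℤ) : 0 < dlen p := by unfold dlen; positivity

lemma dyadic_eq (p : ℤ × ℤ) : dyadic p = Set.Ico (dlen p * p.2) (dlen p * (p.2 + 1)) := rfl

lemma measurableSet_dyadic (p : ℤ × ℤ) : MeasurableSet (dyadic p) := measurableSet_Ico

lemma volume_real_dyadic (p : ℤ × ℤ) : volume.real (dyadic p) = dlen p := by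
  have := dlen_pos p
  rw [dyadic_eq, Real.volume_real_Ico_of_le (by nlinarith)]
  ring

lemma setIntegral_dyadic (f : ℝ → ℝ) (p : ℤ × ℤ) : ∫ x in dyadic p, f x = dlen p * avg f p := by
  rw [avg, mul_inv_cancel_left₀ (dlen_pos p).ne']

lemma dyadic_subset_iff (p : ℤ × ℤ) :
    dyadic p ⊆ Set.Ico (0:ℝ) 1 ↔ ∃ i k : ℕ, k < 2 ^ i ∧ p = ((i:ℤ), (k:ℤ)) := by
  have hd := dlen_pos p
  rw [dyadic_eq, Set.Ico_subset_Ico_iff (by nlinarith)]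
  constructor
  · rintro ⟨h0, h1⟩
    obtain ⟨m, k⟩ := p
    simp only at h0 h1
    have hk : 0 ≤ k := by
      have : (0:ℝ) ≤ k := nonneg_of_mul_nonneg_right h0 hd
      exact_mod_cast this
    have hk1 : (k:ℝ) + 1 ≤ (2:ℝ) ^ m := by
      rw [dlen, zpow_neg, inv_mul_le_iff₀ (by positivity)] at h1
      simpa using h1
    have hm : 0 ≤ m := by
      by_contra! hm
      have h2 : (2:ℝ) ^ m < 1 := zpow_lt_one_of_neg₀ (by norm_num) hm
      have h3 : (0:ℝ) ≤ k := by exact_mod_cast hk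
      linarith
    lift k to ℕ using hk
    lift m to ℕ using hm
    refine ⟨m, k, ?_, rfl⟩
    have : ((k + 1 : ℕ) : ℝ) ≤ ((2 ^ m : ℕ) : ℝ) := by simpa using hk1
    exact_mod_cast this
  · rintro ⟨i, k, hk, rfl⟩
    refine ⟨by positivity, ?_⟩
    have : ((k + 1 : ℕ) : ℝ) ≤ ((2 ^ i : ℕ) : ℝ) := by exact_mod_cast hk
    simp only [dlen, zpow_neg]
    rw [inv_mul_le_iff₀ (by positivity)]
    simpa using this

lemma dyadic_subset {i k : ℕ} (hk : k < 2 ^ i) : dyadic ((i:ℤ), (k:ℤ)) ⊆ Set.Ico (0:ℝ) 1 :=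
  (dyadic_subset_iff _).2 ⟨i, k, hk, rfl⟩

lemma eq_of_mem_dyadic {i k l : ℤ} {x : ℝ} (hk : x ∈ dyadic (i, k)) (hl : x ∈ dyadic (i, l)) :
    k = l := by
  have hd : (0:ℝ) < (2:ℝ) ^ (-i) := by positivity
  obtain ⟨hk0, hk1⟩ := hk
  obtain ⟨hl0, hl1⟩ := hl
  simp only at *
  have h1 : (k:ℝ) < l + 1 := lt_of_mul_lt_mul_left (hk0.trans_lt hl1) hd.le
  have h2 : (l:ℝ) < k + 1 := lt_of_mul_lt_mul_left (hl0.trans_lt hk1) hd.le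
  norm_cast at h1 h2
  omega

/-- The dyadic subintervals of `[0,1)` of generation less than `N`. -/
def unitDyadics (N : ℕ) : Finset (ℤ × ℤ) :=
  ((Finset.range N).sigma fun i => Finset.range (2 ^ i)).map
    ⟨fun x => ((x.1:ℤ), (x.2:ℤ)), fun ⟨i, k⟩ ⟨j, l⟩ h => by simp_all⟩

lemma mem_unitDyadics {N : ℕ} {p : ℤ × ℤ} :
    p ∈ unitDyadics N ↔ dyadic p ⊆ Set.Ico (0:ℝ) 1 ∧ p.1 < N := by
  simp only [unitDyadics, Finset.mem_map, Finset.mem_sigma, Finset.mem_range, dyadic_subset_iff]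
  constructor
  · rintro ⟨⟨i, k⟩, ⟨h1, h2⟩, rfl⟩
    exact ⟨⟨i, k, h2, rfl⟩, Int.ofNat_lt.2 h1⟩
  · rintro ⟨⟨i, k, hk, rfl⟩, h⟩
    exact ⟨⟨i, k⟩, ⟨by simpa using h, hk⟩, rfl⟩

lemma sum_unitDyadics {M : Type*} [AddCommMonoid M] (N : ℕ) (f : ℤ × ℤ → M) :
    ∑ p ∈ unitDyadics N, f p =
      ∑ i ∈ Finset.range N, ∑ k ∈ Finset.range (2 ^ i), f ((i:ℤ), (k:ℤ)) := by
  rw [unitDyadics, Finset.sum_map, Finset.sum_sigma]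
  rfl

lemma Lmap_apply (A : ℕ → ℕ → ℝ) {i j k l : ℕ} (hk : k < 2 ^ i) (hl : l < 2 ^ j) :
    Lmap A ((i:ℤ), (k:ℤ)) ((j:ℤ), (l:ℤ)) = rootLen i * rootLen j * A i j := by
  rw [Lmap, if_pos ⟨dyadic_subset hk, dyadic_subset hl⟩, rootLen, rootLen,
    ← Real.rpow_add two_pos]
  simp only [Int.toNat_natCast, Int.cast_natCast]
  congr 2
  ring

lemma avg_zero (p : ℤ × ℤ) : avg 0 p = 0 := by simp [avg]

lemma pairSum_Lmap (A : ℕ → ℕ → ℝ) {u g : ℤ × ℤ → ℝ → ℝ} {N : ℕ}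
    (hu : ∀ p, u p ≠ 0 → p.1 < N) (hg : ∀ p, g p ≠ 0 → p.1 < N) :
    pairSum (Lmap A) u g = ∑ i ∈ Finset.range N, ∑ j ∈ Finset.range N,
      ∑ k ∈ Finset.range (2 ^ i), ∑ l ∈ Finset.range (2 ^ j),
        rootLen i * rootLen j * A i j * avg (g ((j:ℤ), (l:ℤ))) ((i:ℤ), (k:ℤ)) *
          avg (u ((i:ℤ), (k:ℤ))) ((j:ℤ), (l:ℤ)) := by
  rw [pairSum, tsum_eq_sum (s := unitDyadics N ×ˢ unitDyadics N), Finset.sum_product,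
    sum_unitDyadics]
  · refine Finset.sum_congr rfl fun i _ => ?_
    simp only [sum_unitDyadics]
    rw [Finset.sum_comm]
    refine Finset.sum_congr rfl fun j _ => Finset.sum_congr rfl fun k hk =>
      Finset.sum_congr rfl fun l hl => ?_
    rw [Lmap_apply A (Finset.mem_range.1 hk) (Finset.mem_range.1 hl)]
  · rintro ⟨p, q⟩ h
    simp only
    by_cases hup : u p = 0
    · simp [hup, avg_zero]
    by_cases hgq : g q = 0
    · simp [hgq, avg_zero]
    rw [Lmap, if_neg, zero_mul, zero_mul]
    rintro ⟨h1, h2⟩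
    exact h (Finset.mk_mem_product (mem_unitDyadics.2 ⟨h1, hu p hup⟩)
      (mem_unitDyadics.2 ⟨h2, hg q hgq⟩))

open Classical in
/-- The family constant in space with total mass `a_i²` on the intervals of generation `i`. -/
def constFamily (a : ℕ → ℝ) : ℤ × ℤ → ℝ → ℝ := fun p =>
  if dyadic p ⊆ Set.Ico (0:ℝ) 1 then
    (Set.Ico (0:ℝ) 1).indicator fun _ => a p.1.toNat * rootLen p.1.toNat
  else 0

lemma constFamily_apply (a : ℕ → ℝ) {i k : ℕ} (hk : k < 2 ^ i) :
    constFamily a ((i:ℤ), (k:ℤ)) = (Set.Ico (0:ℝ) 1).indicator fun _ => a i * rootLen i := by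
  simp [constFamily, dyadic_subset hk]

lemma avg_constFamily (a : ℕ → ℝ) {i k j l : ℕ} (hk : k < 2 ^ i) (hl : l < 2 ^ j) :
    avg (constFamily a ((i:ℤ), (k:ℤ))) ((j:ℤ), (l:ℤ)) = a i * rootLen i := by
  rw [avg, constFamily_apply a hk, setIntegral_indicator measurableSet_Ico,
    Set.inter_eq_left.2 (dyadic_subset hl), setIntegral_const, volume_real_dyadic, smul_eq_mul,
    inv_mul_cancel_left₀ (dlen_pos _).ne']

lemma integral_sq_constFamily (a : ℕ → ℝ) {i k : ℕ} (hk : k < 2 ^ i) :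
    ∫ x, (constFamily a ((i:ℤ), (k:ℤ)) x) ^ 2 = a i ^ 2 * (rootLen i * rootLen i) := by
  have : (fun x => (constFamily a ((i:ℤ), (k:ℤ)) x) ^ 2) =
      (Set.Ico (0:ℝ) 1).indicator fun _ => (a i * rootLen i) ^ 2 := by
    rw [constFamily_apply a hk]
    ext x
    by_cases hx : x ∈ Set.Ico (0:ℝ) 1 <;> simp [hx]
  rw [this, integral_indicator measurableSet_Ico, setIntegral_const]
  simp
  ring

lemma constFamily_ne_zero {a : ℕ → ℝ} {N : ℕ} (ha : ∀ i, a i ≠ 0 → i < N) (p : ℤ × ℤ)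
    (hp : constFamily a p ≠ 0) : p ∈ unitDyadics N := by
  by_cases hd : dyadic p ⊆ Set.Ico (0:ℝ) 1
  · refine mem_unitDyadics.2 ⟨hd, ?_⟩
    obtain ⟨i, k, hk, rfl⟩ := (dyadic_subset_iff p).1 hd
    rw [constFamily_apply a hk] at hp
    have : a i ≠ 0 := by
      rintro h
      apply hp
      simp only [h, zero_mul]
      exact Set.indicator_zero _ _
    exact Int.ofNat_lt.2 (ha i this)
  · exact absurd (if_neg hd) hp

lemma exists_forall_lt_of_finite {ι : Type*} {s : Set ι} (hs : s.Finite) (f : ι → ℤ) :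
    ∃ N : ℕ, ∀ p ∈ s, f p < N := by
  obtain ⟨M, hM⟩ := (hs.image f).bddAbove
  refine ⟨M.toNat + 1, fun p hp => ?_⟩
  have := hM (Set.mem_image_of_mem f hp)
  push_cast
  have := Int.self_le_toNat M
  omega

lemma FinUnit.exists_lt {a : ℕ → ℝ} (ha : a ∈ FinUnit) : ∃ N : ℕ, ∀ i, a i ≠ 0 → i < N := by
  obtain ⟨N, hN⟩ := exists_forall_lt_of_finite ha.1 (fun i : ℕ => (i:ℤ))
  exact ⟨N, fun i hi => by exact_mod_cast hN i hi⟩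

lemma constFamily_mem_Adm {a : ℕ → ℝ} (ha : a ∈ FinUnit) : constFamily a ∈ Adm := by
  obtain ⟨N, hN⟩ := FinUnit.exists_lt ha
  refine ⟨fun p => ?_, (unitDyadics N).finite_toSet.subset fun p hp =>
    constFamily_ne_zero hN p hp, ?_⟩
  · unfold constFamily
    split_ifs
    · exact memLp_indicator_const 2 measurableSet_Ico _ (by simp)
    · exact MemLp.zero
  · rw [tsum_eq_sum (s := unitDyadics N), sum_unitDyadics, ← ha.2,
      tsum_eq_sum (s := Finset.range N)]
    · refine Finset.sum_congr rfl fun i _ => ?_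
      rw [Finset.sum_congr rfl fun k hk => integral_sq_constFamily a (Finset.mem_range.1 hk),
        Finset.sum_const, Finset.card_range, nsmul_eq_mul]
      push_cast
      linear_combination (a i ^ 2) * rootLen_sq_mul i
    · intro i hi
      have : a i = 0 := by
        by_contra h
        exact hi (Finset.mem_range.2 (hN i h))
      simp [this]
    · intro p hp
      have : constFamily a p = 0 := by
        by_contra h
        exact hp (constFamily_ne_zero hN p h)
      simp [this]

lemma tsum_matrix {A : ℕ → ℕ → ℝ} {a b : ℕ → ℝ} {N : ℕ} (ha : ∀ i, a i ≠ 0 → i < N)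
    (hb : ∀ i, b i ≠ 0 → i < N) :
    ∑' ij : ℕ × ℕ, A ij.1 ij.2 * a ij.1 * b ij.2 =
      ∑ i ∈ Finset.range N, ∑ j ∈ Finset.range N, A i j * a i * b j := by
  rw [tsum_eq_sum (s := Finset.range N ×ˢ Finset.range N), Finset.sum_product]
  rintro ⟨i, j⟩ h
  by_contra h0
  simp only [mul_eq_zero, not_or] at h0
  exact h (by simp [ha i h0.1.2, hb j h0.2])

lemma pairSum_constFamily (A : ℕ → ℕ → ℝ) {a b : ℕ → ℝ} (ha : a ∈ FinUnit) (hb : b ∈ FinUnit) :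
    pairSum (Lmap A) (constFamily a) (constFamily b) =
      ∑' ij : ℕ × ℕ, A ij.1 ij.2 * a ij.1 * b ij.2 := by
  obtain ⟨M, hM⟩ := FinUnit.exists_lt ha
  obtain ⟨N, hN⟩ := FinUnit.exists_lt hb
  have hM' : ∀ i, a i ≠ 0 → i < max M N := fun i hi => (hM i hi).trans_le (le_max_left _ _)
  have hN' : ∀ i, b i ≠ 0 → i < max M N := fun i hi => (hN i hi).trans_le (le_max_right _ _)
  rw [tsum_matrix hM' hN',
    pairSum_Lmap A (fun p hp => (mem_unitDyadics.1 (constFamily_ne_zero hM' p hp)).2)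
      (fun p hp => (mem_unitDyadics.1 (constFamily_ne_zero hN' p hp)).2)]
  refine Finset.sum_congr rfl fun i _ => Finset.sum_congr rfl fun j _ => ?_
  have h : ∀ k ∈ Finset.range (2 ^ i), ∀ l ∈ Finset.range (2 ^ j),
      rootLen i * rootLen j * A i j * avg (constFamily b ((j:ℤ), (l:ℤ))) ((i:ℤ), (k:ℤ)) *
          avg (constFamily a ((i:ℤ), (k:ℤ))) ((j:ℤ), (l:ℤ)) =
        rootLen i * rootLen j * A i j * (b j * rootLen j) * (a i * rootLen i) := by
    intro k hk l hl
    rw [Finset.mem_range] at hk hl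
    rw [avg_constFamily b hl hk, avg_constFamily a hk hl]
  rw [Finset.sum_congr rfl fun k hk => Finset.sum_congr rfl (h k hk)]
  simp only [Finset.sum_const, Finset.card_range, nsmul_eq_mul]
  push_cast
  linear_combination (A i j * a i * b j) * (2 ^ j * (rootLen j * rootLen j)) * rootLen_sq_mul i +
    (A i j * a i * b j) * rootLen_sq_mul j

lemma matNorm_le_Xnorm_Lmap (A : ℕ → ℕ → ℝ) : matNorm A ≤ Xnorm (Lmap A) := by
  refine iSup_le fun a => iSup_le fun b => ?_
  rw [← pairSum_constFamily A a.2 b.2]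
  exact le_iSup₂_of_le (f := fun (u g : Adm) => ENNReal.ofReal |pairSum (Lmap A) u.1 g.1|)
    ⟨_, constFamily_mem_Adm a.2⟩ ⟨_, constFamily_mem_Adm b.2⟩ le_rfl

lemma truncate_mem_FinUnit {v : ℕ → ℝ} {N : ℕ} (hv : 0 < ∑ i ∈ Finset.range N, v i ^ 2) :
    (fun i => if i < N then v i / √(∑ i ∈ Finset.range N, v i ^ 2) else 0) ∈ FinUnit := by
  refine ⟨(Finset.range N).finite_toSet.subset fun i hi => ?_, ?_⟩
  · by_contra h
    simp_all
  · rw [tsum_eq_sum (s := Finset.range N)]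
    · rw [Finset.sum_congr rfl (g := fun i => v i ^ 2 / ∑ i ∈ Finset.range N, v i ^ 2)]
      · rw [← Finset.sum_div, div_self hv.ne']
      · intro i hi
        simp only [if_pos (Finset.mem_range.1 hi)]
        rw [div_pow, Real.sq_sqrt hv.le]
    · intro i hi
      simp_all

lemma abs_sum_matrix_le {A : ℕ → ℕ → ℝ} (hA : matNorm A ≠ ⊤) (N : ℕ) (v w : ℕ → ℝ) :
    |∑ i ∈ Finset.range N, ∑ j ∈ Finset.range N, A i j * v i * w j| ≤
      (matNorm A).toReal / 2 *
        (∑ i ∈ Finset.range N, v i ^ 2 + ∑ j ∈ Finset.range N, w j ^ 2) := by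
  have hC : 0 ≤ (matNorm A).toReal := ENNReal.toReal_nonneg
  have hzero : ∀ x : ℕ → ℝ, ∑ i ∈ Finset.range N, x i ^ 2 = 0 → ∀ i ∈ Finset.range N, x i = 0 :=
    fun x hx i hi => by
      simpa using (Finset.sum_eq_zero_iff_of_nonneg fun i _ => sq_nonneg (x i)).1 hx i hi
  have hv0 : 0 ≤ ∑ i ∈ Finset.range N, v i ^ 2 := Finset.sum_nonneg fun i _ => sq_nonneg _
  have hw0 : 0 ≤ ∑ i ∈ Finset.range N, w i ^ 2 := Finset.sum_nonneg fun i _ => sq_nonneg _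
  rcases hv0.eq_or_lt with hv | hv
  · rw [Finset.sum_eq_zero fun i hi => Finset.sum_eq_zero fun j _ => by
      rw [hzero v hv.symm i hi]; ring]
    simp only [abs_zero]
    positivity
  rcases hw0.eq_or_lt with hw | hw
  · rw [Finset.sum_eq_zero fun i _ => Finset.sum_eq_zero fun j hj => by
      rw [hzero w hw.symm j hj]; ring]
    simp only [abs_zero]
    positivity
  have key := le_iSup₂ (f := fun (a b : FinUnit) =>
      ENNReal.ofReal |∑' ij : ℕ × ℕ, A ij.1 ij.2 * a.1 ij.1 * b.1 ij.2|)
    ⟨_, truncate_mem_FinUnit hv⟩ ⟨_, truncate_mem_FinUnit hw⟩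
  change _ ≤ matNorm A at key
  rw [← ENNReal.ofReal_toReal hA, ENNReal.ofReal_le_ofReal_iff hC,
    tsum_matrix (N := N) (fun i hi => by by_contra h; simp [h] at hi)
      (fun i hi => by by_contra h; simp [h] at hi)] at key
  set S := ∑ i ∈ Finset.range N, v i ^ 2 with hS
  set T := ∑ i ∈ Finset.range N, w i ^ 2 with hT
  have hsum : ∑ i ∈ Finset.range N, ∑ j ∈ Finset.range N, A i j * v i * w j =
      √S * √T * ∑ i ∈ Finset.range N, ∑ j ∈ Finset.range N,
        A i j * (if i < N then v i / √S else 0) * (if j < N then w j / √T else 0) := by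
    simp only [Finset.mul_sum]
    refine Finset.sum_congr rfl fun i hi => Finset.sum_congr rfl fun j hj => ?_
    rw [if_pos (Finset.mem_range.1 hi), if_pos (Finset.mem_range.1 hj)]
    have := Real.sqrt_pos.2 hv
    have := Real.sqrt_pos.2 hw
    field_simp
  rw [hsum, abs_mul, abs_of_nonneg (by positivity)]
  calc _ ≤ √S * √T * (matNorm A).toReal := by gcongr
    _ ≤ (S + T) / 2 * (matNorm A).toReal := by
        gcongr
        nlinarith [sq_nonneg (√S - √T), Real.sq_sqrt hv.le, Real.sq_sqrt hw.le]
    _ = _ := by ring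

/-- The function `(x, y) ↦ 2^{i/2} Σ_I 1_I(x) u_I(y)`, summed over the dyadic subintervals `I` of
`[0,1)` of generation `i`. -/
def planar (u : ℤ × ℤ → ℝ → ℝ) (i : ℕ) (z : ℝ × ℝ) : ℝ :=
  ∑ k ∈ Finset.range (2 ^ i),
    (rootLen i)⁻¹ * ((dyadic ((i:ℤ), (k:ℤ))).indicator 1 z.1 * u ((i:ℤ), (k:ℤ)) z.2)

/-- Lebesgue measure on `[0,1)`. -/
def unitMeasure : Measure ℝ := volume.restrict (Set.Ico 0 1)

instance : IsFiniteMeasure unitMeasure := by unfold unitMeasure; infer_instance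

lemma integral_indicator_unitMeasure (f : ℝ → ℝ) {i k : ℕ} (hk : k < 2 ^ i) :
    ∫ x, (dyadic ((i:ℤ), (k:ℤ))).indicator f x ∂unitMeasure =
      rootLen i * rootLen i * avg f ((i:ℤ), (k:ℤ)) := by
  rw [integral_indicator (measurableSet_dyadic _), unitMeasure,
    Measure.restrict_restrict (measurableSet_dyadic _), Set.inter_eq_left.2 (dyadic_subset hk),
    setIntegral_dyadic, dlen_natCast]

lemma planar_mul_planar_swap (u g : ℤ × ℤ → ℝ → ℝ) (i j : ℕ) (z : ℝ × ℝ) :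
    planar u i z * planar g j z.swap =
      ∑ k ∈ Finset.range (2 ^ i), ∑ l ∈ Finset.range (2 ^ j), (rootLen i)⁻¹ * (rootLen j)⁻¹ *
        ((dyadic ((i:ℤ), (k:ℤ))).indicator (g ((j:ℤ), (l:ℤ))) z.1 *
          (dyadic ((j:ℤ), (l:ℤ))).indicator (u ((i:ℤ), (k:ℤ))) z.2) := by
  rw [planar, planar, Finset.sum_mul_sum]
  refine Finset.sum_congr rfl fun k _ => Finset.sum_congr rfl fun l _ => ?_
  by_cases h1 : z.1 ∈ dyadic ((i:ℤ), (k:ℤ)) <;> by_cases h2 : z.2 ∈ dyadic ((j:ℤ), (l:ℤ)) <;>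
    simp [h1, h2]
  ring

lemma planar_sq (u : ℤ × ℤ → ℝ → ℝ) (i : ℕ) (z : ℝ × ℝ) :
    planar u i z ^ 2 = ∑ k ∈ Finset.range (2 ^ i), (rootLen i)⁻¹ * (rootLen i)⁻¹ *
      ((dyadic ((i:ℤ), (k:ℤ))).indicator 1 z.1 * u ((i:ℤ), (k:ℤ)) z.2 ^ 2) := by
  rw [sq, planar, Finset.sum_mul_sum]
  refine Finset.sum_congr rfl fun k hk => ?_
  rw [Finset.sum_eq_single_of_mem k hk]
  · by_cases h : z.1 ∈ dyadic ((i:ℤ), (k:ℤ)) <;> simp [h]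
    ring
  · intro l _ hlk
    by_cases h1 : z.1 ∈ dyadic ((i:ℤ), (k:ℤ)) <;> by_cases h2 : z.1 ∈ dyadic ((i:ℤ), (l:ℤ)) <;>
      simp [h1, h2]
    exact absurd (by exact_mod_cast eq_of_mem_dyadic h2 h1) hlk

section Integrals

variable {u g : ℤ × ℤ → ℝ → ℝ}

lemma integrable_unitMeasure (hu : ∀ p, MemLp (u p) 2 volume) (p : ℤ × ℤ) :
    Integrable (u p) unitMeasure :=
  ((hu p).restrict _).integrable (by norm_num)

lemma integrable_planar_sq (hu : ∀ p, MemLp (u p) 2 volume) (i : ℕ) :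
    Integrable (fun z => planar u i z ^ 2) (unitMeasure.prod unitMeasure) := by
  simp only [planar_sq]
  refine integrable_finsetSum _ fun k _ => Integrable.const_mul ?_ _
  exact ((integrable_const (1:ℝ)).indicator (measurableSet_dyadic _)).mul_prod
    ((hu _).restrict _).integrable_sq

lemma integral_planar_sq_le (hu : ∀ p, MemLp (u p) 2 volume) (i : ℕ) :
    ∫ z, planar u i z ^ 2 ∂unitMeasure.prod unitMeasure ≤
      ∑ k ∈ Finset.range (2 ^ i), ∫ x, u ((i:ℤ), (k:ℤ)) x ^ 2 := by
  simp only [planar_sq]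
  rw [integral_finsetSum]
  · refine Finset.sum_le_sum fun k hk => ?_
    rw [integral_const_mul, integral_prod_mul (fun x => (dyadic ((i:ℤ), (k:ℤ))).indicator 1 x)
      (fun y => u ((i:ℤ), (k:ℤ)) y ^ 2),
      integral_indicator_unitMeasure _ (Finset.mem_range.1 hk)]
    have havg : avg 1 ((i:ℤ), (k:ℤ)) = 1 := by
      simp [avg, volume_real_dyadic, (dlen_pos _).ne']
    rw [havg, mul_one, ← mul_assoc]
    have hr := (rootLen_pos i).ne'
    rw [show (rootLen i)⁻¹ * (rootLen i)⁻¹ * (rootLen i * rootLen i) = 1 by field_simp, one_mul]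
    exact setIntegral_le_integral (hu _).integrable_sq (ae_of_all _ fun x => sq_nonneg _)
  · intro k _
    refine Integrable.const_mul ?_ _
    exact ((integrable_const (1:ℝ)).indicator (measurableSet_dyadic _)).mul_prod
      ((hu _).restrict _).integrable_sq

lemma integrable_indicator_mul_indicator (hu : ∀ p, MemLp (u p) 2 volume)
    (hg : ∀ p, MemLp (g p) 2 volume) (c : ℝ) (p q : ℤ × ℤ) :
    Integrable (fun z : ℝ × ℝ => c * ((dyadic p).indicator (g q) z.1 *
      (dyadic q).indicator (u p) z.2)) (unitMeasure.prod unitMeasure) :=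
  (((integrable_unitMeasure hg _).indicator (measurableSet_dyadic _)).mul_prod
    ((integrable_unitMeasure hu _).indicator (measurableSet_dyadic _))).const_mul c

lemma integrable_planar_mul_planar_swap (hu : ∀ p, MemLp (u p) 2 volume)
    (hg : ∀ p, MemLp (g p) 2 volume) (i j : ℕ) :
    Integrable (fun z => planar u i z * planar g j z.swap) (unitMeasure.prod unitMeasure) := by
  simp only [planar_mul_planar_swap]
  exact integrable_finsetSum _ fun k _ => integrable_finsetSum _ fun l _ =>
    integrable_indicator_mul_indicator hu hg _ _ _

lemma integral_planar_mul_planar_swap (hu : ∀ p, MemLp (u p) 2 volume)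
    (hg : ∀ p, MemLp (g p) 2 volume) (i j : ℕ) :
    ∫ z, planar u i z * planar g j z.swap ∂unitMeasure.prod unitMeasure =
      ∑ k ∈ Finset.range (2 ^ i), ∑ l ∈ Finset.range (2 ^ j), rootLen i * rootLen j *
        avg (g ((j:ℤ), (l:ℤ))) ((i:ℤ), (k:ℤ)) * avg (u ((i:ℤ), (k:ℤ))) ((j:ℤ), (l:ℤ)) := by
  simp only [planar_mul_planar_swap]
  rw [integral_finsetSum _ fun k _ => integrable_finsetSum _ fun l _ =>
    integrable_indicator_mul_indicator hu hg _ _ _]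
  refine Finset.sum_congr rfl fun k hk => ?_
  rw [integral_finsetSum _ fun l _ => integrable_indicator_mul_indicator hu hg _ _ _]
  refine Finset.sum_congr rfl fun l hl => ?_
  rw [integral_const_mul, integral_prod_mul
    (fun x => (dyadic ((i:ℤ), (k:ℤ))).indicator (g ((j:ℤ), (l:ℤ))) x)
    (fun y => (dyadic ((j:ℤ), (l:ℤ))).indicator (u ((i:ℤ), (k:ℤ))) y),
    integral_indicator_unitMeasure _ (Finset.mem_range.1 hk),
    integral_indicator_unitMeasure _ (Finset.mem_range.1 hl)]
  have := (rootLen_pos i).ne'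
  have := (rootLen_pos j).ne'
  field_simp

end Integrals

lemma sum_integral_planar_sq_le_one {u : ℤ × ℤ → ℝ → ℝ} (hu : u ∈ Adm) (N : ℕ) :
    ∑ i ∈ Finset.range N, ∫ z, planar u i z ^ 2 ∂unitMeasure.prod unitMeasure ≤ 1 := by
  calc _ ≤ ∑ i ∈ Finset.range N, ∑ k ∈ Finset.range (2 ^ i), ∫ x, u ((i:ℤ), (k:ℤ)) x ^ 2 :=
        Finset.sum_le_sum fun i _ => integral_planar_sq_le hu.1 i
    _ = ∑ p ∈ unitDyadics N, ∫ x, u p x ^ 2 := (sum_unitDyadics N fun p => ∫ x, u p x ^ 2).symm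
    _ ≤ ∑' p : ℤ × ℤ, ∫ x, u p x ^ 2 := by
        refine Summable.sum_le_tsum _ (fun p _ => integral_nonneg fun x => sq_nonneg _) ?_
        refine summable_of_hasFiniteSupport (hu.2.1.subset fun p hp h => hp ?_)
        simp [h]
    _ = 1 := hu.2.2

lemma abs_pairSum_Lmap_le {A : ℕ → ℕ → ℝ} (hA : matNorm A ≠ ⊤) {u g : ℤ × ℤ → ℝ → ℝ}
    (hu : u ∈ Adm) (hg : g ∈ Adm) : |pairSum (Lmap A) u g| ≤ (matNorm A).toReal := by
  obtain ⟨M, hM⟩ := exists_forall_lt_of_finite hu.2.1 Prod.fst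
  obtain ⟨M', hM'⟩ := exists_forall_lt_of_finite hg.2.1 Prod.fst
  set N := max M M' with hN
  have hint : ∀ i j, Integrable (fun z => A i j * planar u i z * planar g j z.swap)
      (unitMeasure.prod unitMeasure) := fun i j => by
    simpa only [mul_assoc] using
      (integrable_planar_mul_planar_swap hu.1 hg.1 i j).const_mul (A i j)
  have hsum : pairSum (Lmap A) u g = ∫ z, ∑ i ∈ Finset.range N, ∑ j ∈ Finset.range N,
      A i j * planar u i z * planar g j z.swap ∂unitMeasure.prod unitMeasure := by
    rw [pairSum_Lmap A (N := N) (fun p hp => (hM p hp).trans_le (by simp [hN]))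
      (fun p hp => (hM' p hp).trans_le (by simp [hN])),
      integral_finsetSum _ fun i _ => integrable_finsetSum _ fun j _ => hint i j]
    refine Finset.sum_congr rfl fun i _ => ?_
    rw [integral_finsetSum _ fun j _ => hint i j]
    refine Finset.sum_congr rfl fun j _ => ?_
    simp only [mul_assoc (A i j)]
    rw [integral_const_mul, integral_planar_mul_planar_swap hu.1 hg.1]
    simp only [Finset.mul_sum]
    refine Finset.sum_congr rfl fun k _ => Finset.sum_congr rfl fun l _ => ?_
    ring
  have hiu := fun i => integrable_planar_sq hu.1 i
  have hig : ∀ j, Integrable (fun z => planar g j z.swap ^ 2) (unitMeasure.prod unitMeasure) :=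
    fun j => (integrable_planar_sq hg.1 j).swap
  have hswap : ∀ j, ∫ z, planar g j z.swap ^ 2 ∂unitMeasure.prod unitMeasure =
      ∫ z, planar g j z ^ 2 ∂unitMeasure.prod unitMeasure := fun j =>
    integral_prod_swap (μ := unitMeasure) (ν := unitMeasure) fun z => planar g j z ^ 2
  have hiU := integrable_finsetSum (Finset.range N) fun i _ => hiu i
  have hiG := integrable_finsetSum (Finset.range N) fun j _ => hig j
  rw [hsum, ← Real.norm_eq_abs]
  calc _ ≤ ∫ z, (matNorm A).toReal / 2 * (∑ i ∈ Finset.range N, planar u i z ^ 2 +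
        ∑ j ∈ Finset.range N, planar g j z.swap ^ 2) ∂unitMeasure.prod unitMeasure :=
        norm_integral_le_of_norm_le ((hiU.add hiG).const_mul _) (ae_of_all _ fun z =>
          abs_sum_matrix_le hA N (fun i => planar u i z) fun j => planar g j z.swap)
    _ = (matNorm A).toReal / 2 *
        (∑ i ∈ Finset.range N, ∫ z, planar u i z ^ 2 ∂unitMeasure.prod unitMeasure +
          ∑ j ∈ Finset.range N, ∫ z, planar g j z ^ 2 ∂unitMeasure.prod unitMeasure) := by
        rw [integral_const_mul, integral_add hiU hiG, integral_finsetSum _ fun i _ => hiu i,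
          integral_finsetSum _ fun j _ => hig j]
        simp only [hswap]
    _ ≤ (matNorm A).toReal / 2 * (1 + 1) := by
        gcongr
        exacts [sum_integral_planar_sq_le_one hu N, sum_integral_planar_sq_le_one hg N]
    _ = (matNorm A).toReal := by ring

lemma Xnorm_Lmap_le_matNorm (A : ℕ → ℕ → ℝ) : Xnorm (Lmap A) ≤ matNorm A := by
  by_cases hA : matNorm A = ⊤
  · simp [hA]
  · exact iSup_le fun u => iSup_le fun g =>
      ENNReal.ofReal_le_of_le_toReal (abs_pairSum_Lmap_le hA u.2 g.2)

/-- `‖A‖_{ℓ²(ℕ)→ℓ²(ℕ)} = ‖L(A)‖_X` as elements of `[0,∞]`; in particular `A` is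
bounded on `ℓ²(ℕ)` iff the space-independent paraproduct sequence `L(A)` lies in `X`. -/
theorem matrix_norm_eq_Xnorm_Lmap (A : ℕ → ℕ → ℝ) :
    matNorm A = Xnorm (Lmap A) ∧ (matNorm A < ⊤ ↔ Xnorm (Lmap A) < ⊤) := by
  have h := (matNorm_le_Xnorm_Lmap A).antisymm (Xnorm_Lmap_le_matNorm A)
  exact ⟨h, by rw [h]⟩

end
end

section
/- For every real matrix A = (A^{ij})_{i,j∈ℕ} that is bounded on ℓ²(ℕ), the operator M_{L(A)} is bounded on ℓ²_ℤ(L²(ℝ²)) with ‖M_{L(A)}‖ ≤ ‖A‖_{ℓ²(ℕ)→ℓ²(ℕ)}. -/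
open MeasureTheory
open scoped ENNReal

noncomputable section

/-- `I_i(x)`: (the encoding of) the unique dyadic interval of length `2^{-i}` containing `x`. -/
def Iat (i : ℤ) (x : ℝ) : ℤ × ℤ := (i, ⌊(2:ℝ) ^ i * x⌋)

/-- The matrix entries `M_λ^{ij}(x,y) = 2^{(i+j)/2} λ_{I_i(x) I_j(y)}`. -/
def Ment (lam : ParaSeq) (i j : ℤ) (z : ℝ × ℝ) : ℝ :=
  (2:ℝ) ^ (((i : ℝ) + (j : ℝ)) / 2) * lam (Iat i z.1) (Iat j z.2)

/-- `(M_λ a)_j(x,y) = Σ_i M_λ^{ij}(x,y) a_i(x,y)`. -/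
def Mapply (lam : ParaSeq) (a : ℤ → ℝ × ℝ → ℝ) (j : ℤ) (z : ℝ × ℝ) : ℝ :=
  ∑' i : ℤ, Ment lam i j z * a i z

/-- The unit ball of `ℓ²_ℤ(L²(ℝ²))` (measurable representatives). -/
def Mball : Set (ℤ → ℝ × ℝ → ℝ) :=
  {a | (∀ i, Measurable (a i)) ∧ (∑' i : ℤ, ∫⁻ z : ℝ × ℝ, ENNReal.ofReal ((a i z) ^ 2)) ≤ 1}

/-- The operator norm `‖M_λ‖` of `M_λ` on `ℓ²_ℤ(L²(ℝ²))`, as an element of `[0, ∞]`. -/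
def MopNorm (lam : ParaSeq) : ℝ≥0∞ :=
  ⨆ a : Mball,
    (∑' j : ℤ, ∫⁻ z : ℝ × ℝ, ENNReal.ofReal ((Mapply lam a.1 j z) ^ 2)) ^ (1/2 : ℝ)

lemma mem_dyadic_Iat (i : ℤ) (x : ℝ) : x ∈ dyadic (Iat i x) := by
  have h2 : (0:ℝ) < 2 ^ i := by positivity
  simp only [dyadic, Iat, zpow_neg, Set.mem_Ico]
  rw [inv_mul_le_iff₀ h2, lt_inv_mul_iff₀ h2]
  exact ⟨Int.floor_le _, Int.lt_floor_add_one _⟩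

lemma dyadic_Iat_subset_iff (i : ℤ) (x : ℝ) :
    dyadic (Iat i x) ⊆ Set.Ico (0:ℝ) 1 ↔ 0 ≤ i ∧ x ∈ Set.Ico (0:ℝ) 1 := by
  constructor
  · intro h
    refine ⟨?_, h (mem_dyadic_Iat i x)⟩
    by_contra! hi
    have h2 : (0:ℝ) < 2 ^ (-i) := by positivity
    have h3 : (1:ℝ) < 2 ^ (-i) := one_lt_zpow₀ (by norm_num) (by omega)
    rw [dyadic, Set.Ico_subset_Ico_iff (by simp only [Iat]; nlinarith)] at h
    simp only [Iat] at h
    nlinarith [h.1, h.2]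
  · rintro ⟨hi, hx0, hx1⟩
    lift i to ℕ using hi
    have h2 : (0:ℝ) < 2 ^ (i : ℤ) := by positivity
    have hk0 : 0 ≤ ⌊(2:ℝ) ^ (i : ℤ) * x⌋ := Int.floor_nonneg.2 (by positivity)
    have hk1 : ⌊(2:ℝ) ^ (i : ℤ) * x⌋ < 2 ^ i := by
      rw [Int.floor_lt]
      push_cast
      rw [zpow_natCast] at *
      nlinarith
    refine Set.Ico_subset_Ico ?_ ?_
    · simp only [Iat]
      positivity
    · simp only [Iat, zpow_neg]
      rw [inv_mul_le_iff₀ h2, mul_one, zpow_natCast]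
      rw [zpow_natCast] at hk1
      exact_mod_cast hk1

lemma Ment_Lmap_of_mem (A : ℕ → ℕ → ℝ) {z : ℝ × ℝ}
    (hz : z.1 ∈ Set.Ico (0:ℝ) 1 ∧ z.2 ∈ Set.Ico (0:ℝ) 1) (m n : ℕ) :
    Ment (Lmap A) m n z = A m n := by
  rw [Ment, Lmap, if_pos ⟨(dyadic_Iat_subset_iff _ _).2 ⟨by positivity, hz.1⟩,
    (dyadic_Iat_subset_iff _ _).2 ⟨by positivity, hz.2⟩⟩]
  simp only [Iat, Int.toNat_natCast]
  rw [← mul_assoc, ← Real.rpow_add (by norm_num), add_neg_cancel, Real.rpow_zero, one_mul]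

lemma Ment_Lmap_eq_zero (A : ℕ → ℕ → ℝ) {i j : ℤ} {z : ℝ × ℝ}
    (h : ¬ ((0 ≤ i ∧ z.1 ∈ Set.Ico (0:ℝ) 1) ∧ 0 ≤ j ∧ z.2 ∈ Set.Ico (0:ℝ) 1)) :
    Ment (Lmap A) i j z = 0 := by
  rw [Ment, Lmap, if_neg, mul_zero]
  rwa [dyadic_Iat_subset_iff, dyadic_Iat_subset_iff]

lemma Mapply_Lmap_natCast (A : ℕ → ℕ → ℝ) (a : ℤ → ℝ × ℝ → ℝ) {z : ℝ × ℝ}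
    (hz : z.1 ∈ Set.Ico (0:ℝ) 1 ∧ z.2 ∈ Set.Ico (0:ℝ) 1) (n : ℕ) :
    Mapply (Lmap A) a n z = ∑' m : ℕ, A m n * a m z := by
  rw [Mapply, ← (Nat.cast_injective (R := ℤ)).tsum_eq]
  · simp only [Ment_Lmap_of_mem A hz]
  · intro i hi
    by_contra h
    refine hi ?_
    simp only
    rw [Ment_Lmap_eq_zero, zero_mul]
    rintro ⟨⟨h0, -⟩, -⟩
    exact h ⟨i.toNat, Int.toNat_of_nonneg h0⟩

lemma Mapply_Lmap_eq_zero (A : ℕ → ℕ → ℝ) (a : ℤ → ℝ × ℝ → ℝ) {j : ℤ} {z : ℝ × ℝ}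
    (h : ¬ (0 ≤ j ∧ z.1 ∈ Set.Ico (0:ℝ) 1 ∧ z.2 ∈ Set.Ico (0:ℝ) 1)) :
    Mapply (Lmap A) a j z = 0 := by
  rw [Mapply, tsum_congr fun i => ?_, tsum_zero]
  rw [Ment_Lmap_eq_zero A (by tauto), zero_mul]

lemma mem_FinUnit_of_sum_pos {s : Finset ℕ} {u : ℕ → ℝ} (h : 0 < ∑ i ∈ s, u i ^ 2) :
    (fun i => if i ∈ s then u i / √(∑ i ∈ s, u i ^ 2) else 0) ∈ FinUnit := by
  refine ⟨s.finite_toSet.subset fun i hi => ?_, ?_⟩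
  · by_contra h'
    exact hi (if_neg h')
  · rw [tsum_eq_sum (s := s) fun i hi => by simp [hi],
      Finset.sum_congr rfl fun i hi => by
        beta_reduce
        rw [if_pos hi, div_pow, Real.sq_sqrt h.le],
      ← Finset.sum_div, div_self h.ne']

lemma abs_sum_le_matNorm {A : ℕ → ℕ → ℝ} (hA : matNorm A < ⊤) (s t : Finset ℕ) (u v : ℕ → ℝ) :
    |∑ i ∈ s, ∑ j ∈ t, A i j * u i * v j| ≤
      (matNorm A).toReal * √(∑ i ∈ s, u i ^ 2) * √(∑ j ∈ t, v j ^ 2) := by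
  have hsum {r : Finset ℕ} {w : ℕ → ℝ} (h : ∑ i ∈ r, w i ^ 2 = 0) : ∀ i ∈ r, w i = 0 := by
    intro i hi
    simpa using (Finset.sum_eq_zero_iff_of_nonneg fun i _ => sq_nonneg (w i)).1 h i hi
  rcases (Finset.sum_nonneg fun i _ => sq_nonneg (u i) : 0 ≤ ∑ i ∈ s, u i ^ 2).eq_or_lt
    with hu | hu
  · rw [Finset.sum_eq_zero fun i hi => Finset.sum_eq_zero fun j _ => by simp [hsum hu.symm i hi]]
    simp only [abs_zero]
    positivity
  rcases (Finset.sum_nonneg fun i _ => sq_nonneg (v i) : 0 ≤ ∑ j ∈ t, v j ^ 2).eq_or_lt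
    with hv | hv
  · rw [Finset.sum_eq_zero fun i _ => Finset.sum_eq_zero fun j hj => by simp [hsum hv.symm j hj]]
    simp only [abs_zero]
    positivity
  have hle := (ENNReal.ofReal_le_iff_le_toReal hA.ne).1 <|
    le_iSup₂ (f := fun (a b : FinUnit) =>
      ENNReal.ofReal |∑' ij : ℕ × ℕ, A ij.1 ij.2 * a.1 ij.1 * b.1 ij.2|)
      ⟨_, mem_FinUnit_of_sum_pos hu⟩ ⟨_, mem_FinUnit_of_sum_pos hv⟩
  have hsu := Real.sqrt_pos.2 hu
  have hsv := Real.sqrt_pos.2 hv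
  rw [tsum_eq_sum (s := s ×ˢ t) fun ij hij => by
      rw [Finset.mem_product, not_and_or] at hij
      rcases hij with h | h <;> simp [h], Finset.sum_product,
    Finset.sum_congr rfl fun i hi => Finset.sum_congr rfl fun j hj =>
      show _ = A i j * u i * v j / (√(∑ i ∈ s, u i ^ 2) * √(∑ j ∈ t, v j ^ 2)) by
        dsimp only
        rw [if_pos hi, if_pos hj, ← mul_div_assoc (A i j), div_mul_div_comm]] at hle
  simp only [← Finset.sum_div] at hle
  rwa [abs_div, abs_of_pos (mul_pos hsu hsv), div_le_iff₀ (mul_pos hsu hsv), ← mul_assoc] at hle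

lemma sum_sq_sum_le_matNorm {A : ℕ → ℕ → ℝ} (hA : matNorm A < ⊤) (s t : Finset ℕ) (u : ℕ → ℝ) :
    ∑ j ∈ t, (∑ i ∈ s, A i j * u i) ^ 2 ≤ (matNorm A).toReal ^ 2 * ∑ i ∈ s, u i ^ 2 := by
  have h := abs_sum_le_matNorm hA s t u fun j => ∑ i ∈ s, A i j * u i
  rw [Finset.sum_comm] at h
  simp only [← Finset.sum_mul, ← sq] at h
  set S := ∑ j ∈ t, (∑ i ∈ s, A i j * u i) ^ 2
  have hS : 0 ≤ S := Finset.sum_nonneg fun j _ => sq_nonneg _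
  have hU : 0 ≤ ∑ i ∈ s, u i ^ 2 := Finset.sum_nonneg fun j _ => sq_nonneg _
  rw [abs_of_nonneg hS] at h
  rcases hS.eq_or_lt with h0 | h0
  · rw [← h0]
    positivity
  have hle : √S ≤ (matNorm A).toReal * √(∑ i ∈ s, u i ^ 2) := by
    refine le_of_mul_le_mul_right ?_ (Real.sqrt_pos.2 h0)
    rwa [Real.mul_self_sqrt hS]
  calc S = √S ^ 2 := (Real.sq_sqrt hS).symm
    _ ≤ ((matNorm A).toReal * √(∑ i ∈ s, u i ^ 2)) ^ 2 := by gcongr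
    _ = _ := by rw [mul_pow, Real.sq_sqrt hU]

lemma summable_col_sq {A : ℕ → ℕ → ℝ} (hA : matNorm A < ⊤) (j : ℕ) :
    Summable fun i => A i j ^ 2 := by
  refine summable_of_sum_le (c := (matNorm A).toReal ^ 2) (fun i => sq_nonneg _) fun s => ?_
  have h := sum_sq_sum_le_matNorm hA s {j} fun i => A i j
  simp only [Finset.sum_singleton, ← sq (A _ _)] at h
  rcases (Finset.sum_nonneg fun i _ => sq_nonneg (A i j) : 0 ≤ ∑ i ∈ s, A i j ^ 2).eq_or_lt
    with h0 | h0
  · rw [← h0]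
    positivity
  · rw [sq (∑ i ∈ s, A i j ^ 2)] at h
    exact le_of_mul_le_mul_right h h0

lemma sum_sq_tsum_le_matNorm {A : ℕ → ℕ → ℝ} (hA : matNorm A < ⊤) {u : ℕ → ℝ}
    (hu : Summable fun i => u i ^ 2) (t : Finset ℕ) :
    ∑ j ∈ t, (∑' i, A i j * u i) ^ 2 ≤ (matNorm A).toReal ^ 2 * ∑' i, u i ^ 2 := by
  have hs (j : ℕ) : Summable fun i => A i j * u i := by
    refine Summable.of_norm_bounded ((summable_col_sq hA j).add hu) fun i => ?_
    rw [Real.norm_eq_abs, abs_le]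
    constructor <;> nlinarith [sq_nonneg (A i j + u i), sq_nonneg (A i j - u i),
      sq_nonneg (A i j), sq_nonneg (u i)]
  exact le_of_tendsto_of_tendsto' (tendsto_finsetSum t fun j _ => (hs j).hasSum.pow 2)
    (hu.hasSum.const_mul _) fun s => sum_sq_sum_le_matNorm hA s t u

lemma tsum_ofReal_sq_tsum_le_matNorm {A : ℕ → ℕ → ℝ} (hA : matNorm A < ⊤) {u : ℕ → ℝ}
    (hu : Summable fun i => u i ^ 2) :
    ∑' j, ENNReal.ofReal ((∑' i, A i j * u i) ^ 2) ≤
      matNorm A ^ 2 * ∑' i, ENNReal.ofReal (u i ^ 2) := by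
  rw [← ENNReal.ofReal_tsum_of_nonneg (fun i => sq_nonneg _) hu, ← ENNReal.ofReal_toReal hA.ne,
    ← ENNReal.ofReal_pow ENNReal.toReal_nonneg, ← ENNReal.ofReal_mul (by positivity)]
  refine ENNReal.summable.tsum_le_of_sum_le fun t => ?_
  rw [← ENNReal.ofReal_sum_of_nonneg fun j _ => sq_nonneg _]
  exact ENNReal.ofReal_le_ofReal (sum_sq_tsum_le_matNorm hA hu t)

lemma tsum_Mapply_Lmap_sq_le {A : ℕ → ℕ → ℝ} (hA : matNorm A < ⊤) (a : ℤ → ℝ × ℝ → ℝ)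
    {z : ℝ × ℝ} (ha : ∑' i : ℤ, ENNReal.ofReal (a i z ^ 2) ≠ ⊤) :
    ∑' j : ℤ, ENNReal.ofReal (Mapply (Lmap A) a j z ^ 2) ≤
      matNorm A ^ 2 * ∑' i : ℤ, ENNReal.ofReal (a i z ^ 2) := by
  by_cases hz : z.1 ∈ Set.Ico (0:ℝ) 1 ∧ z.2 ∈ Set.Ico (0:ℝ) 1
  · have hle : ∑' m : ℕ, ENNReal.ofReal (a m z ^ 2) ≤ ∑' i : ℤ, ENNReal.ofReal (a i z ^ 2) :=
      ENNReal.tsum_comp_le_tsum_of_injective Nat.cast_injective _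
    rw [← (Nat.cast_injective (R := ℤ)).tsum_eq]
    · simp only [Mapply_Lmap_natCast A a hz]
      refine (tsum_ofReal_sq_tsum_le_matNorm hA ?_).trans (by gcongr)
      simpa [ENNReal.toReal_ofReal, sq_nonneg] using
        ENNReal.summable_toReal (ne_top_of_le_ne_top ha hle)
    · intro j hj
      by_contra h
      refine hj ?_
      simp only
      rw [Mapply_Lmap_eq_zero A a fun h' => h ⟨j.toNat, Int.toNat_of_nonneg h'.1⟩]
      simp
  · rw [tsum_congr fun j => by rw [Mapply_Lmap_eq_zero A a fun h => hz h.2]]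
    simp

lemma tsum_lintegral_le_lintegral_tsum {α ι : Type*} [MeasurableSpace α] (μ : Measure α)
    (f : ι → α → ℝ≥0∞) : ∑' i, ∫⁻ x, f i x ∂μ ≤ ∫⁻ x, ∑' i, f i x ∂μ := by
  classical
  refine ENNReal.summable.tsum_le_of_sum_le fun s => ?_
  refine le_trans ?_ (lintegral_mono fun x => ENNReal.sum_le_tsum s)
  induction s using Finset.induction_on with
  | empty => simp
  | insert i s hi ih =>
    simp only [Finset.sum_insert hi]
    exact (add_le_add_right ih _).trans (le_lintegral_add _ _)

/-- if the matrix `A` is bounded on `ℓ²(ℕ)`, then `M_{L(A)}` is bounded on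
`ℓ²_ℤ(L²(ℝ²))` with `‖M_{L(A)}‖ ≤ ‖A‖_{ℓ²(ℕ)→ℓ²(ℕ)}`. -/
theorem MopNorm_Lmap_le_matNorm (A : ℕ → ℕ → ℝ) (hA : matNorm A < ⊤) :
    MopNorm (Lmap A) ≤ matNorm A := by
  refine iSup_le fun ⟨a, ham, ha⟩ => ?_
  have hmeas (i : ℤ) : Measurable fun z => ENNReal.ofReal (a i z ^ 2) :=
    ((ham i).pow_const 2).ennreal_ofReal
  rw [← lintegral_tsum fun i => (hmeas i).aemeasurable] at ha
  have hfin := ae_lt_top' (Measurable.tsum hmeas).aemeasurable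
    (ne_top_of_le_ne_top ENNReal.one_ne_top ha)
  have hle : ∑' j : ℤ, ∫⁻ z : ℝ × ℝ, ENNReal.ofReal (Mapply (Lmap A) a j z ^ 2) ≤
      matNorm A ^ 2 :=
    calc _ ≤ ∫⁻ z : ℝ × ℝ, ∑' j : ℤ, ENNReal.ofReal (Mapply (Lmap A) a j z ^ 2) :=
          tsum_lintegral_le_lintegral_tsum _ _
      _ ≤ ∫⁻ z : ℝ × ℝ, matNorm A ^ 2 * ∑' i : ℤ, ENNReal.ofReal (a i z ^ 2) :=
          lintegral_mono_ae (hfin.mono fun z hz => tsum_Mapply_Lmap_sq_le hA a hz.ne)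
      _ = matNorm A ^ 2 * ∫⁻ z : ℝ × ℝ, ∑' i : ℤ, ENNReal.ofReal (a i z ^ 2) :=
          lintegral_const_mul _ (Measurable.tsum hmeas)
      _ ≤ matNorm A ^ 2 := mul_le_of_le_one_right' ha
  calc _ ≤ (matNorm A ^ 2) ^ (1 / 2 : ℝ) := ENNReal.rpow_le_rpow hle (by norm_num)
    _ = matNorm A := by
      rw [← ENNReal.rpow_natCast, ← ENNReal.rpow_mul]
      norm_num

end
end

section
/- There exists a sequence λ = (λ_{IJ}) with λ_{IJ} ≥ 0 for all dyadic intervals I, J, such that ‖λ‖_{X'} < ∞ (so the mixed paraproduct P_λ is unconditionally bounded on L²(ℝ²)) but ‖λ‖_{BMO_rect} = ∞ (so λ does not belong to rectangular BMO, and a fortiori not to product BMO). -/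
open MeasureTheory
open scoped ENNReal

noncomputable section

/-- The rectangular BMO norm `‖λ‖_{BMO_rect}`, as an element of `[0, ∞]`. -/
def rectBMO (lam : ParaSeq) : ℝ≥0∞ :=
  ⨆ (p : ℤ × ℤ) (q : ℤ × ℤ),
    ((ENNReal.ofReal (dlen p * dlen q))⁻¹ *
      ∑' r : {r : (ℤ × ℤ) × (ℤ × ℤ) // dyadic r.1 ⊆ dyadic p ∧ dyadic r.2 ⊆ dyadic q},
        ENNReal.ofReal ((lam r.1.1 r.1.2) ^ 2)) ^ (1/2 : ℝ)

lemma volume_dyadic (p : ℤ × ℤ) : volume (dyadic p) = ENNReal.ofReal (dlen p) := by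
  unfold dyadic dlen
  rw [Real.volume_Ico]
  congr 1
  ring

/-- Distinct dyadic intervals of the same generation are disjoint. -/
lemma disjoint_dyadic {p q : ℤ × ℤ} (h : p.1 = q.1) (hne : p ≠ q) :
    Disjoint (dyadic p) (dyadic q) := by
  rw [Set.disjoint_left]
  rintro x ⟨hp1, hp2⟩ ⟨hq1, hq2⟩
  rw [← h] at hq1 hq2
  have hpos : (0 : ℝ) < 2 ^ (-p.1) := by positivity
  have h1 : (p.2 : ℝ) < q.2 + 1 := lt_of_mul_lt_mul_left (hp1.trans_lt hq2) hpos.le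
  have h2 : (q.2 : ℝ) < p.2 + 1 := lt_of_mul_lt_mul_left (hq1.trans_lt hp2) hpos.le
  norm_cast at h1 h2
  exact hne (Prod.ext h (by omega))

/-- The Cauchy–Schwarz inequality for averages: `|I| ⟨f⟩_I² ≤ ∫_I f²`. -/
lemma dlen_mul_avg_sq_le {f : ℝ → ℝ} (hf : MemLp f 2 volume) (p : ℤ × ℤ) :
    dlen p * avg f p ^ 2 ≤ ∫ x in dyadic p, f x ^ 2 := by
  have : IsFiniteMeasure (volume.restrict (dyadic p)) :=
    ⟨by rw [Measure.restrict_apply_univ, volume_dyadic]; exact ENNReal.ofReal_lt_top⟩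
  have hf' : MemLp f 2 (volume.restrict (dyadic p)) := hf.restrict _
  have hint : Integrable f (volume.restrict (dyadic p)) := hf'.integrable (by norm_num)
  have hsq : Integrable (fun x ↦ f x ^ 2) (volume.restrict (dyadic p)) := hf'.integrable_sq
  have hd := dlen_pos p
  have hreal : (volume.restrict (dyadic p)).real Set.univ = dlen p := by
    rw [measureReal_restrict_apply_univ, measureReal_def, volume_dyadic,
      ENNReal.toReal_ofReal hd.le]
  have hI : ∫ x in dyadic p, f x = dlen p * avg f p := by
    unfold avg
    field_simp
  have hnonneg : 0 ≤ ∫ x in dyadic p, (f x - avg f p) ^ 2 :=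
    integral_nonneg fun x ↦ sq_nonneg _
  have hexp : ∫ x in dyadic p, (f x - avg f p) ^ 2
      = (∫ x in dyadic p, f x ^ 2) - dlen p * avg f p ^ 2 := by
    have : (fun x ↦ (f x - avg f p) ^ 2)
        = fun x ↦ f x ^ 2 - (2 * avg f p * f x - avg f p ^ 2) := by
      funext x
      ring
    have hlin : Integrable (fun x ↦ 2 * avg f p * f x - avg f p ^ 2)
        (volume.restrict (dyadic p)) := (hint.const_mul _).sub (integrable_const _)
    rw [this, integral_sub hsq hlin,
      integral_sub (hint.const_mul _) (integrable_const _), integral_const_mul, integral_const,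
      hI, hreal, smul_eq_mul]
    ring
  linarith

/-- The integrals of a square over finitely many dyadic intervals of one generation add up to at
most the full integral. -/
lemma sum_setIntegral_dyadic_le {f : ℝ → ℝ} (hf : MemLp f 2 volume) (s : Finset (ℤ × ℤ)) (i : ℤ) :
    ∑ p ∈ s with p.1 = i, ∫ x in dyadic p, f x ^ 2 ≤ ∫ x, f x ^ 2 := by
  have hsq : Integrable (fun x ↦ f x ^ 2) volume := hf.integrable_sq
  rw [← integral_biUnion_finset _ (fun p _ ↦ measurableSet_dyadic p) _
    (fun p _ ↦ hsq.integrableOn)]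
  · exact setIntegral_le_integral hsq (Filter.Eventually.of_forall fun x ↦ sq_nonneg _)
  · intro p hp q hq hne
    simp only [Finset.coe_filter, Set.mem_ofPred_eq] at hp hq
    exact disjoint_dyadic (hp.2.trans hq.2.symm) hne

lemma sum_integral_sq_le_one {u : (ℤ × ℤ) → ℝ → ℝ} (hu : u ∈ Adm) (s : Finset (ℤ × ℤ)) :
    ∑ p ∈ s, ∫ x, u p x ^ 2 ≤ 1 := by
  obtain ⟨-, hfin, hsum⟩ := hu
  rw [← hsum]
  refine Summable.sum_le_tsum s (fun p _ ↦ integral_nonneg fun x ↦ sq_nonneg _) ?_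
  refine summable_of_hasFiniteSupport (hfin.subset fun p hp h0 ↦ hp ?_)
  simp [h0]

lemma sum_sum_setIntegral_le_one {u : (ℤ × ℤ) → ℝ → ℝ} (hu : u ∈ Adm) (s t : Finset (ℤ × ℤ)) :
    ∑ q ∈ t, ∑ p ∈ s with p.1 = q.1, ∫ x in dyadic p, u q x ^ 2 ≤ 1 :=
  (Finset.sum_le_sum fun q _ ↦ sum_setIntegral_dyadic_le (hu.1 q) s q.1).trans
    (sum_integral_sq_le_one hu t)

/-- The sequence with `λ_{IJ} = |I|` if `|I| = |J|`, and `λ_{IJ} = 0` otherwise. -/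
def squareSeq : ParaSeq := fun p q ↦ if p.1 = q.1 then dlen p else 0

lemma abs_squareSeq_mul_le {u g : (ℤ × ℤ) → ℝ → ℝ} (hu : u ∈ Adm) (hg : g ∈ Adm) (p q : ℤ × ℤ) :
    |squareSeq p q * avg (g q) p * avg (u p) q| ≤
      if p.1 = q.1 then
        ((∫ x in dyadic p, g q x ^ 2) + ∫ x in dyadic q, u p x ^ 2) / 2
      else 0 := by
  unfold squareSeq
  split_ifs with h
  · have h1 := dlen_mul_avg_sq_le (hg.1 q) p
    have h2 := dlen_mul_avg_sq_le (hu.1 p) q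
    have hl : dlen q = dlen p := by simp [dlen, h]
    rw [hl] at h2
    have hd := dlen_pos p
    rw [abs_le]
    constructor <;>
      nlinarith [mul_nonneg hd.le (sq_nonneg (avg (g q) p - avg (u p) q)),
        mul_nonneg hd.le (sq_nonneg (avg (g q) p + avg (u p) q))]
  · simp

lemma Xprime_squareSeq_le_one : Xprime squareSeq ≤ 1 := by
  refine iSup_le fun ⟨u, hu⟩ ↦ iSup_le fun ⟨g, hg⟩ ↦ ?_
  rw [← ENNReal.ofReal_one]
  refine ENNReal.ofReal_le_ofReal ?_
  refine Real.tsum_le_of_sum_le (fun _ ↦ abs_nonneg _) fun r ↦ ?_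
  set s := r.image Prod.fst
  set t := r.image Prod.snd
  have hgs := sum_sum_setIntegral_le_one hg s t
  have hut := sum_sum_setIntegral_le_one hu t s
  calc ∑ pq ∈ r, |squareSeq pq.1 pq.2 * avg (g pq.2) pq.1 * avg (u pq.1) pq.2|
      ≤ ∑ pq ∈ s ×ˢ t, |squareSeq pq.1 pq.2 * avg (g pq.2) pq.1 * avg (u pq.1) pq.2| :=
        Finset.sum_le_sum_of_subset_of_nonneg Finset.subset_product fun _ _ _ ↦ abs_nonneg _
    _ ≤ ∑ pq ∈ s ×ˢ t, ((if pq.1.1 = pq.2.1 then ∫ x in dyadic pq.1, g pq.2 x ^ 2 else 0) / 2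
          + (if pq.2.1 = pq.1.1 then ∫ x in dyadic pq.2, u pq.1 x ^ 2 else 0) / 2) := by
        refine Finset.sum_le_sum fun pq _ ↦ (abs_squareSeq_mul_le hu hg pq.1 pq.2).trans_eq ?_
        by_cases h : pq.1.1 = pq.2.1
        · simp only [h, if_true]
          ring
        · simp [h, Ne.symm h]
    _ = (∑ q ∈ t, ∑ p ∈ s with p.1 = q.1, ∫ x in dyadic p, g q x ^ 2) / 2
          + (∑ p ∈ s, ∑ q ∈ t with q.1 = p.1, ∫ x in dyadic q, u p x ^ 2) / 2 := by
        rw [Finset.sum_add_distrib, ← Finset.sum_div, ← Finset.sum_div, Finset.sum_product_right,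
          Finset.sum_product]
        simp only [Finset.sum_filter]
    _ ≤ 1 := by linarith

lemma dyadic_subset_unit (i : ℕ) (k : Fin (2 ^ i)) :
    dyadic ((i : ℤ), ((k : ℕ) : ℤ)) ⊆ dyadic (0, 0) := by
  have hk : ((k : ℕ) : ℝ) + 1 ≤ 2 ^ i := by exact_mod_cast k.2
  have hpos : (0 : ℝ) < 2 ^ i := by positivity
  unfold dyadic
  refine Set.Ico_subset_Ico ?_ ?_
  · simp
  · simp only [zpow_neg, zpow_natCast, Int.cast_natCast]
    rw [inv_mul_le_iff₀ hpos]
    simpa using hk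

lemma tsum_squareSeq_sq_eq_top :
    ∑' r : {r : (ℤ × ℤ) × (ℤ × ℤ) // dyadic r.1 ⊆ dyadic (0, 0) ∧ dyadic r.2 ⊆ dyadic (0, 0)},
      ENNReal.ofReal ((squareSeq r.1.1 r.1.2) ^ 2) = ⊤ := by
  let φ : (Σ i : ℕ, Fin (2 ^ i) × Fin (2 ^ i)) →
      {r : (ℤ × ℤ) × (ℤ × ℤ) // dyadic r.1 ⊆ dyadic (0, 0) ∧ dyadic r.2 ⊆ dyadic (0, 0)} :=
    fun a ↦ ⟨(((a.1 : ℤ), ((a.2.1 : ℕ) : ℤ)), ((a.1 : ℤ), ((a.2.2 : ℕ) : ℤ))),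
      dyadic_subset_unit _ _, dyadic_subset_unit _ _⟩
  have hφ : Function.Injective φ := by
    rintro ⟨i, k, l⟩ ⟨i', k', l'⟩ h
    simp only [φ, Subtype.mk.injEq, Prod.mk.injEq, Nat.cast_inj] at h
    obtain ⟨⟨rfl, hk⟩, -, hl⟩ := h
    rw [Fin.ext hk, Fin.ext hl]
  have hle := ENNReal.tsum_comp_le_tsum_of_injective hφ
    (fun r ↦ ENNReal.ofReal ((squareSeq r.1.1 r.1.2) ^ 2))
  refine top_le_iff.mp (le_trans (le_of_eq ?_) hle)
  rw [ENNReal.tsum_sigma']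
  have hone (i : ℕ) : ∑' a : Fin (2 ^ i) × Fin (2 ^ i),
      ENNReal.ofReal ((squareSeq (φ ⟨i, a⟩).1.1 (φ ⟨i, a⟩).1.2) ^ 2) = 1 := by
    have hval (a : Fin (2 ^ i) × Fin (2 ^ i)) :
        squareSeq (φ ⟨i, a⟩).1.1 (φ ⟨i, a⟩).1.2 = ((2 : ℝ) ^ i)⁻¹ := by
      simp [squareSeq, φ, dlen]
    simp only [hval]
    rw [tsum_fintype, Finset.sum_const, ← ENNReal.ofReal_nsmul, ← ENNReal.ofReal_one]
    congr 1
    simp only [Finset.card_univ, Fintype.card_prod, Fintype.card_fin, nsmul_eq_mul]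
    push_cast
    field_simp
  simp only [hone, ENNReal.tsum_const_eq_top_of_ne_zero one_ne_zero]

lemma rectBMO_squareSeq : rectBMO squareSeq = ⊤ := by
  refine top_le_iff.mp (le_trans (le_of_eq ?_) (le_iSup₂ ((0, 0) : ℤ × ℤ) ((0, 0) : ℤ × ℤ)))
  rw [tsum_squareSeq_sq_eq_top]
  simp [dlen]

/-- there is a non-negative sequence `λ` with `‖λ‖_{X'} < ∞` (so `P_λ` is
unconditionally bounded on `L²(ℝ²)`) but `‖λ‖_{BMO_rect} = ∞`. -/
theorem exists_unconditionally_bounded_not_rectBMO :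
    ∃ lam : ParaSeq, (∀ p q, 0 ≤ lam p q) ∧ Xprime lam < ⊤ ∧ rectBMO lam = ⊤ := by
  exact ⟨squareSeq, fun p q ↦ by unfold squareSeq; split_ifs <;> simp [(dlen_pos p).le],
    Xprime_squareSeq_le_one.trans_lt ENNReal.one_lt_top, rectBMO_squareSeq⟩

end
end
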